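/- Suppose p > 2. Let a11 ∈ F_q^× and b3,b5,b6,b7 ∈ F_q. Define λ on K = {0}×V by λ(t3,t5,t6,t7,t8,t9,t10,t11) = φ(b5·t5 + b6·t6 + b7·t7 + a11·t11), and set χ(x(t)) = φ(b3·t3)·λ^H(x(t)). Then: (a) χ(x(t)) = 0 whenever (t1,t2,t4) ≠ (0,0,0); (b) for t with t1 = t2 = t4 = t5 = t6 = t7 = 0 and t3 ∈ F_q^×, χ(x(t)) = q·φ(b3·t3 + a11·t11)·(q·δ + S), where δ = 1 if b6·t3 + a11·t9 = 0 and b7·t3 + a11·t8 = 0 and δ = 0 otherwise, and S = ∑_{s ∈ F_q^×} φ(−(b5·t3 + a11·t10)·s + (b6·t3 + a11·t9)·(b7·t3 + a11·t8)·(a11·t3)^{−1}·s^{−1}). -/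

import Mathlib

open Finset
open scoped Classical

noncomputable section

/-- The additive character `φ(x) = exp(2πi·Tr(x)/p)` of `F_q`, where `Tr` is the trace to `F_p`. -/
def phi (p : ℕ) (F : Type) [Field F] [Fintype F] [Algebra (ZMod p) F] (x : F) : ℂ :=
  Complex.exp (2 * Real.pi * Complex.I * ((Algebra.trace (ZMod p) F x).val : ℂ) / (p : ℂ))

namespace UM12

variable (F : Type) [Field F] [Fintype F]

/- `V = F_q^8` has coordinates `(t3,t5,t6,t7,t8,t9,t10,t11)`, indexed `0,…,7`. -/

/-- `σ1(s) : t5 ↦ t5 − s·t3, t8 ↦ t8 − s·t6, t9 ↦ t9 − s·t7, t11 ↦ t11 − s·t10`. -/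
def sig1 (s : F) (v : Fin 8 → F) : Fin 8 → F :=
  ![v 0, v 1 - s * v 0, v 2, v 3, v 4 - s * v 2, v 5 - s * v 3, v 6, v 7 - s * v 6]

/-- `σ2(s) : t6 ↦ t6 − s·t3, t8 ↦ t8 − s·t5, t10 ↦ t10 − s·t7, t11 ↦ t11 − s·t9`. -/
def sig2 (s : F) (v : Fin 8 → F) : Fin 8 → F :=
  ![v 0, v 1, v 2 - s * v 0, v 3, v 4 - s * v 1, v 5, v 6 - s * v 3, v 7 - s * v 5]

/-- `σ4(s) : t7 ↦ t7 − s·t3, t9 ↦ t9 − s·t5, t10 ↦ t10 − s·t6, t11 ↦ t11 − s·t8`. -/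
def sig4 (s : F) (v : Fin 8 → F) : Fin 8 → F :=
  ![v 0, v 1, v 2, v 3 - s * v 0, v 4, v 5 - s * v 1, v 6 - s * v 2, v 7 - s * v 4]

/-- The composite action `σ1(s1)σ2(s2)σ4(s4)` of `F_q^3` on `V`. -/
def sigma (s : Fin 3 → F) (v : Fin 8 → F) : Fin 8 → F :=
  sig1 F (s 0) (sig2 F (s 1) (sig4 F (s 2) v))

/-- Multiplication in the semidirect product `H = F_q^3 ⋉ V`:
conjugating `(0,v)` by `(s,0)` yields `(0, σ1(s1)σ2(s2)σ4(s4)(v))`. -/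
def Hmul (x y : (Fin 3 → F) × (Fin 8 → F)) : (Fin 3 → F) × (Fin 8 → F) :=
  (x.1 + y.1, sigma F y.1 x.2 + y.2)

/-- Inversion in `H`. -/
def Hinv (x : (Fin 3 → F) × (Fin 8 → F)) : (Fin 3 → F) × (Fin 8 → F) :=
  (-x.1, -(sigma F (-x.1) x.2))

/-- Conjugation `x⁻¹ h x` in `H`. -/
def Hconj (x h : (Fin 3 → F) × (Fin 8 → F)) : (Fin 3 → F) × (Fin 8 → F) :=
  Hmul F (Hmul F (Hinv F x) h) x

/-- The element `x(t) = (0,(t3,0,…,0))·((t1,t2,t4),0)·(0,(0,t5,t6,t7,t8,t9,t10,t11))` of `H`,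
for `t = (t1,…,t11)` (indexed `0,…,10`). -/
def xelt (t : Fin 11 → F) : (Fin 3 → F) × (Fin 8 → F) :=
  Hmul F
    (Hmul F ((0 : Fin 3 → F), ![t 2, 0, 0, 0, 0, 0, 0, 0]) (![t 0, t 1, t 3], (0 : Fin 8 → F)))
    ((0 : Fin 3 → F), ![0, t 4, t 5, t 6, t 7, t 8, t 9, t 10])

/-- The extension by zero `λ̇` to `H` of a function `λ` on `K = {0} × V`. -/
def lamDot (lam : (Fin 8 → F) → ℂ) (h : (Fin 3 → F) × (Fin 8 → F)) : ℂ :=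
  if h.1 = 0 then lam h.2 else 0

/-- The induced class function `λ^H(h) = (1/q^8) ∑_{x∈H} λ̇(x⁻¹ h x)`. -/
def ind (lam : (Fin 8 → F) → ℂ) (h : (Fin 3 → F) × (Fin 8 → F)) : ℂ :=
  (1 / (Fintype.card F : ℂ) ^ 8) * ∑ x : (Fin 3 → F) × (Fin 8 → F), lamDot F lam (Hconj F x h)

end UM12

/-- `phi` as an additive character. -/
def phiChar (p : ℕ) [Fact p.Prime] (F : Type) [Field F] [Fintype F] [Algebra (ZMod p) F] :
    AddChar F ℂ :=
  (ZMod.stdAddChar (N := p)).compAddMonoidHom (Algebra.trace (ZMod p) F).toAddMonoidHom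

theorem phiChar_apply (p : ℕ) [Fact p.Prime] (F : Type) [Field F] [Fintype F]
    [Algebra (ZMod p) F] (x : F) : phiChar p F x = phi p F x := by
  simp only [phiChar, phi, AddChar.compAddMonoidHom_apply, ZMod.stdAddChar_apply,
    ZMod.toCircle_apply]
  rfl

theorem phi_zero (p : ℕ) [Fact p.Prime] (F : Type) [Field F] [Fintype F]
    [Algebra (ZMod p) F] : phi p F 0 = 1 := by
  rw [← phiChar_apply, AddChar.map_zero_eq_one]

theorem phi_add (p : ℕ) [Fact p.Prime] (F : Type) [Field F] [Fintype F]
    [Algebra (ZMod p) F] (x y : F) : phi p F (x + y) = phi p F x * phi p F y := by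
  simp only [← phiChar_apply, AddChar.map_add_eq_mul]

theorem phiChar_isPrimitive (p : ℕ) [Fact p.Prime] (F : Type) [Field F] [Fintype F]
    [Algebra (ZMod p) F] : (phiChar p F).IsPrimitive := by
  apply AddChar.IsPrimitive.of_ne_one
  intro h
  obtain ⟨x, hx⟩ := Algebra.trace_surjective (ZMod p) F 1
  have h1 : phiChar p F x = 1 := by rw [h, AddChar.one_apply]
  have h2 : ZMod.stdAddChar (N := p) 1 = ZMod.stdAddChar (N := p) 0 := by
    rw [AddChar.map_zero_eq_one, ← h1, ← hx]
    rfl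
  exact one_ne_zero (ZMod.injective_stdAddChar h2)

/-- Orthogonality for the character `phi`. -/
theorem sum_phi_mul (p : ℕ) [Fact p.Prime] (F : Type) [Field F] [Fintype F]
    [Algebra (ZMod p) F] (b : F) :
    ∑ x : F, phi p F (x * b) = if b = 0 then (Fintype.card F : ℂ) else 0 := by
  simp only [← phiChar_apply]
  rw [AddChar.sum_mulShift b (phiChar_isPrimitive p F)]
  split_ifs <;> simp

/-- The sum over `z` forces `B + x * y * d = 0`; for `x ≠ 0` this determines `y`, and the terms
with `x = 0` survive only if `A = B = 0`. -/
theorem sum_phi_cubic (p : ℕ) [Fact p.Prime] (F : Type) [Field F] [Fintype F]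
    [Algebra (ZMod p) F] (A B C d : F) (hd : d ≠ 0) :
    ∑ x : F, ∑ y : F, ∑ z : F, phi p F (-(C * x) + y * (-A) + z * (-(B + x * y * d))) =
      (Fintype.card F : ℂ) * ((Fintype.card F : ℂ) * (if A = 0 ∧ B = 0 then 1 else 0) +
        ∑ s ∈ (Finset.univ : Finset F).erase 0, phi p F (-C * s + A * B * d⁻¹ * s⁻¹)) := by
  simp only [phi_add, ← Finset.mul_sum, sum_phi_mul, neg_eq_zero]
  rw [← Finset.add_sum_erase _ _ (Finset.mem_univ (0 : F)), mul_add]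
  congr 1
  · simp only [zero_mul, mul_zero, neg_zero, phi_zero, one_mul, add_zero, ← Finset.sum_mul]
    rw [sum_phi_mul]
    by_cases hA : A = 0 <;> by_cases hB : B = 0 <;> simp [hA, hB]
  · rw [Finset.mul_sum]
    refine Finset.sum_congr rfl fun x hx => ?_
    have hx0 : x ≠ 0 := Finset.ne_of_mem_erase hx
    rw [Finset.sum_eq_single (-(B * d⁻¹ * x⁻¹))]
    · rw [if_pos (by field_simp; ring), mul_comm]
      congr 3 <;> ring_nf
    · intro y _ hy
      rw [if_neg, mul_zero]
      intro h
      apply hy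
      field_simp
      linear_combination h
    · simp

namespace UM12

theorem Hconj_fst (F : Type) [Field F] (x h : (Fin 3 → F) × (Fin 8 → F)) :
    (Hconj F x h).1 = h.1 := by
  simp [Hconj, Hmul, Hinv]

theorem Hconj_of_fst_eq_zero (F : Type) [Field F] (x : (Fin 3 → F) × (Fin 8 → F))
    (v : Fin 8 → F) : Hconj F x (0, v) = (0, sigma F x.1 v) := by
  refine Prod.ext (Hconj_fst F x _) (funext fun i => ?_)
  fin_cases i <;> simp [Hconj, Hmul, Hinv, sigma, sig1, sig2, sig4, Matrix.vecHead,
    Matrix.vecTail] <;> ring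

/-- An induced function vanishes outside the normal subgroup `{0} × V`. -/
theorem ind_of_fst_ne_zero (F : Type) [Field F] [Fintype F] (lam : (Fin 8 → F) → ℂ)
    (h : (Fin 3 → F) × (Fin 8 → F)) (hh : h.1 ≠ 0) : ind F lam h = 0 := by
  simp [ind, lamDot, Hconj_fst, hh]

/-- On `{0} × V`, an induced function is the sum over the `F_q^3`-orbit. -/
theorem ind_of_fst_eq_zero (F : Type) [Field F] [Fintype F] (lam : (Fin 8 → F) → ℂ)
    (v : Fin 8 → F) :
    ind F lam (0, v) = ∑ x : F, ∑ y : F, ∑ z : F, lam (sigma F ![x, y, z] v) := by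
  have hq : (Fintype.card F : ℂ) ≠ 0 := by simp
  have hs : ∑ s : Fin 3 → F, lam (sigma F s v) =
      ∑ x : F, ∑ y : F, ∑ z : F, lam (sigma F ![x, y, z] v) := by
    let e : (Fin 3 → F) ≃ (F × F) × F :=
      ⟨fun s => ((s 0, s 1), s 2), fun u => ![u.1.1, u.1.2, u.2],
        fun s => by ext i; fin_cases i <;> rfl, fun u => rfl⟩
    rw [← e.symm.sum_comp, Fintype.sum_prod_type, Fintype.sum_prod_type]
    rfl
  rw [← hs]
  simp only [ind, lamDot, Hconj_of_fst_eq_zero, if_true, Fintype.sum_prod_type, Finset.sum_const,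
    Finset.card_univ, Fintype.card_fun, Fintype.card_fin, nsmul_eq_mul, ← Finset.mul_sum]
  push_cast
  field_simp

theorem xelt_fst (F : Type) [Field F] (t : Fin 11 → F) : (xelt F t).1 = ![t 0, t 1, t 3] := by
  simp [xelt, Hmul]

theorem xelt_eq (F : Type) [Field F] (t3 t8 t9 t10 t11 : F) :
    xelt F ![0, 0, t3, 0, 0, 0, 0, t8, t9, t10, t11] = (0, ![t3, 0, 0, 0, t8, t9, t10, t11]) := by
  refine Prod.ext (funext fun i => ?_) (funext fun i => ?_)
  · fin_cases i <;> simp [xelt, Hmul]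
  · fin_cases i <;> simp [xelt, Hmul, sigma, sig1, sig2, sig4]

end UM12

open UM12 in
/-- values of `χ(x(t)) = φ(b3·t3)·λ^H(x(t))`, where
`λ(t3,t5,t6,t7,t8,t9,t10,t11) = φ(b5·t5 + b6·t6 + b7·t7 + a11·t11)` on `K = {0}×V`, for `p > 2`:
(a) `χ(x(t)) = 0` whenever `(t1,t2,t4) ≠ (0,0,0)`;
(b) on `x(t)` with `t1 = t2 = t4 = t5 = t6 = t7 = 0` and `t3 ≠ 0`, the value is
`q·φ(b3·t3 + a11·t11)·(q·δ + S)`. -/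
theorem stmt15 (p : ℕ) [Fact p.Prime] (hp : 2 < p) (F : Type) [Field F] [Fintype F] [CharP F p]
    [Algebra (ZMod p) F] (a11 : F) (h11 : a11 ≠ 0) (b3 b5 b6 b7 : F) :
    (∀ t : Fin 11 → F, ¬(t 0 = 0 ∧ t 1 = 0 ∧ t 3 = 0) →
      phi p F (b3 * t 2) *
        ind F (fun v => phi p F (b5 * v 1 + b6 * v 2 + b7 * v 3 + a11 * v 7)) (xelt F t) = 0) ∧
    (∀ t3 t8 t9 t10 t11 : F, t3 ≠ 0 →
      phi p F (b3 * t3) *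
        ind F (fun v => phi p F (b5 * v 1 + b6 * v 2 + b7 * v 3 + a11 * v 7))
          (xelt F ![0, 0, t3, 0, 0, 0, 0, t8, t9, t10, t11]) =
      (Fintype.card F : ℂ) * phi p F (b3 * t3 + a11 * t11) *
        ((Fintype.card F : ℂ) *
            (if b6 * t3 + a11 * t9 = 0 ∧ b7 * t3 + a11 * t8 = 0 then 1 else 0) +
          ∑ s ∈ (Finset.univ : Finset F).erase 0,
            phi p F (-(b5 * t3 + a11 * t10) * s +
              (b6 * t3 + a11 * t9) * (b7 * t3 + a11 * t8) * (a11 * t3)⁻¹ * s⁻¹))) := by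
  refine ⟨fun t ht => ?_, fun t3 t8 t9 t10 t11 h3 => ?_⟩
  · rw [ind_of_fst_ne_zero, mul_zero]
    rw [xelt_fst]
    intro h
    exact ht ⟨congrFun h 0, congrFun h 1, congrFun h 2⟩
  · rw [xelt_eq, ind_of_fst_eq_zero, phi_add p F (b3 * t3)]
    have key := sum_phi_cubic p F (b6 * t3 + a11 * t9) (b7 * t3 + a11 * t8) (b5 * t3 + a11 * t10)
      (a11 * t3) (mul_ne_zero h11 h3)
    rw [mul_comm (Fintype.card F : ℂ), mul_assoc, mul_assoc, ← key]
    simp only [Finset.mul_sum]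
    refine Finset.sum_congr rfl fun x _ => Finset.sum_congr rfl fun y _ =>
      Finset.sum_congr rfl fun z _ => ?_
    rw [← phi_add p F (a11 * t11)]
    congr 2
    simp [sigma, sig1, sig2, sig4]
    ring
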